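/- Fix n ≥ 1, a covariate matrix X ∈ ℝ^{n×d}, group labels Z ∈ {1,…,H}ⁿ, and a known positive definite matrix Σ ∈ ℝ^{n×n}. Let the kernel have a finite-dimensional feature representation K(x,x') = φ(x)ᵀφ(x') for a map φ : ℝᵈ → ℝ^q with q < ∞, and suppose Y = f₀(X) + ε where f₀(x) = βᵀφ(x) for some β ∈ ℝ^q and ε ~ N(0, σ₀²·Σ) with σ₀ > 0. Then for kernel K, any permutation size b with 1 ≤ b ≤ n − q, any test statistic T, and covariance matrix Σ, both the discrete and the continuous partial permutation p-values with covariance matrix Σ are valid: Pr(p(X,Y,Z,Σ) ≤ α) ≤ α for every α ∈ (0,1). -/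

import Mathlib

open MeasureTheory ProbabilityTheory Filter

noncomputable section

namespace PPT

/-- The law of `k` i.i.d. standard Gaussian random variables. -/
def stdGaussianPi (k : ℕ) : Measure (Fin k → ℝ) :=
  Measure.pi fun _ => gaussianReal 0 1

/-- The law of `n` i.i.d. centered Gaussian noises with standard deviation `σ`. -/
def noiseLaw (n : ℕ) (σ : ℝ) : Measure (Fin n → ℝ) :=
  Measure.pi fun _ => gaussianReal 0 ((σ ^ 2).toNNReal)

/-- Matrix (given as a function) times vector. -/
def mulVecF {n m : ℕ} (A : Fin n → Fin m → ℝ) (v : Fin m → ℝ) : Fin n → ℝ :=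
  fun i => ∑ j, A i j * v j

/-- Transposed matrix times vector, `Aᵀ v`. -/
def tmulVecF {n : ℕ} (A : Fin n → Fin n → ℝ) (v : Fin n → ℝ) : Fin n → ℝ :=
  fun i => ∑ j, A j i * v j

/-- Matrix product of matrices given as functions. -/
def mulF {n : ℕ} (A B : Fin n → Fin n → ℝ) : Fin n → Fin n → ℝ :=
  fun i j => ∑ k, A i k * B k j

/-- The identity matrix as a function. -/
def idF (n : ℕ) : Fin n → Fin n → ℝ :=
  fun i j => if i = j then 1 else 0

/-- Quadratic form `vᵀ A v`. -/
def quadForm {n : ℕ} (A : Fin n → Fin n → ℝ) (v : Fin n → ℝ) : ℝ :=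
  ∑ i, ∑ j, v i * A i j * v j

/-- `A` is an orthogonal matrix: `A Aᵀ = I`. -/
def IsOrthogonalF {n : ℕ} (A : Fin n → Fin n → ℝ) : Prop :=
  ∀ i j, (∑ k, A i k * A j k) = if i = j then (1 : ℝ) else 0

/-- `(Γ, c)` is an eigendecomposition `Kmat = Γ diag(c) Γᵀ` of `Kmat`, with `Γ` orthogonal and
the eigenvalues `c` nonnegative and in nonincreasing order. -/
def IsEigenDecomp {n : ℕ} (Kmat Γ : Fin n → Fin n → ℝ) (c : Fin n → ℝ) : Prop :=
  IsOrthogonalF Γ ∧ (∀ i j, Kmat i j = ∑ k, Γ i k * c k * Γ j k) ∧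
    (∀ i j : Fin n, i ≤ j → c j ≤ c i) ∧ (∀ i, 0 ≤ c i)

/-- A symmetric positive semidefinite kernel on `ℝᵈ`. -/
def IsPSDKernel {d : ℕ} (K : (Fin d → ℝ) → (Fin d → ℝ) → ℝ) : Prop :=
  (∀ x y, K x y = K y x) ∧
    ∀ (m : ℕ) (v : Fin m → (Fin d → ℝ)) (a : Fin m → ℝ),
      0 ≤ ∑ i, ∑ j, a i * a j * K (v i) (v j)

/-- The set `M(n,b)` of permutations of `{0, …, n-1}` keeping the first `n - b` elements fixed. -/
def permSet (n b : ℕ) : Finset (Equiv.Perm (Fin n)) :=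
  Finset.univ.filter fun ψ => ∀ i : Fin n, (i : ℕ) < n - b → ψ i = i

/-- The discrete partial permutation p-value, with covariates `X`, group labels `Z`,
test statistic `T`, eigenvector matrix `Γ`, permutation size `b` and responses `Y`. -/
def pDisc {n d H : ℕ} (X : Fin n → Fin d → ℝ) (Z : Fin n → Fin H)
    (T : (Fin n → Fin d → ℝ) → (Fin n → ℝ) → (Fin n → Fin H) → ℝ)
    (Γ : Fin n → Fin n → ℝ) (b : ℕ) (Y : Fin n → ℝ) : ℝ :=
  ((permSet n b).card : ℝ)⁻¹ *
    ∑ ψ ∈ permSet n b,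
      if T X Y Z ≤ T X (mulVecF Γ ((tmulVecF Γ Y) ∘ ψ)) Z then 1 else 0

/-- Squared norm of the last `b` coordinates of a vector in `ℝⁿ`. -/
def tailNormSq {n : ℕ} (b : ℕ) (w : Fin n → ℝ) : ℝ :=
  ∑ i ∈ Finset.univ.filter (fun i : Fin n => n - b ≤ (i : ℕ)), w i ^ 2

/-- The continuous partial permutation of `w` driven by `g`: it agrees with `w` on the first
`n - b` coordinates, and its last `b` coordinates are those of `g` rescaled to lie on the sphere
of radius `(Σ_{i ≥ n-b} w i ^ 2)^{1/2}`.  When `g` is standard Gaussian, the last `b` coordinates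
are uniformly distributed on that sphere. -/
def wStar {n : ℕ} (b : ℕ) (w g : Fin n → ℝ) : Fin n → ℝ := fun i =>
  if (i : ℕ) < n - b then w i
  else Real.sqrt (tailNormSq b w) * g i / Real.sqrt (tailNormSq b g)

/-- The continuous partial permutation p-value. -/
def pCont {n d H : ℕ} (X : Fin n → Fin d → ℝ) (Z : Fin n → Fin H)
    (T : (Fin n → Fin d → ℝ) → (Fin n → ℝ) → (Fin n → Fin H) → ℝ)
    (Γ : Fin n → Fin n → ℝ) (b : ℕ) (Y : Fin n → ℝ) : ℝ :=
  (stdGaussianPi n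
    {g | T X Y Z ≤ T X (mulVecF Γ (wStar b (tmulVecF Γ Y) g)) Z}).toReal

/-- The chi-squared distribution with `k` degrees of freedom, realized as the law of the sum of
squares of `k` independent standard Gaussians. -/
def chiSq (k : ℕ) : Measure ℝ :=
  Measure.map (fun g : Fin k → ℝ => ∑ i, g i ^ 2) (stdGaussianPi k)

/-- The quantile function of the chi-squared distribution with `k` degrees of freedom. -/
def chiSqQuantile (k : ℕ) (p : ℝ) : ℝ :=
  sInf {x : ℝ | ENNReal.ofReal p ≤ chiSq k (Set.Iic x)}

end PPT

namespace PPT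

/-- A square matrix (as a function) is symmetric. -/
def IsSymmF {n : ℕ} (A : Fin n → Fin n → ℝ) : Prop := ∀ i j, A i j = A j i

/-- A square matrix (as a function) is symmetric positive definite. -/
def IsPosDefF {n : ℕ} (A : Fin n → Fin n → ℝ) : Prop :=
  IsSymmF A ∧ ∀ v : Fin n → ℝ, v ≠ 0 → 0 < quadForm A v

/-- `(Sh, R)` is the pair `(Σ^{1/2}, Σ^{-1/2})` associated with the positive definite matrix
`Sm`: `Sh` is the symmetric positive definite square root of `Sm` and `R` is its inverse. -/
def IsSqrtPair {n : ℕ} (Sm Sh R : Fin n → Fin n → ℝ) : Prop :=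
  IsPosDefF Sh ∧ mulF Sh Sh = Sm ∧ mulF R Sh = idF n ∧ mulF Sh R = idF n

end PPT

namespace PPT

open Matrix

lemma tail_prob_le (ρ : Measure ℝ) [IsProbabilityMeasure ρ] (a : ENNReal) :
    ρ {t | ρ (Set.Ici t) ≤ a} ≤ a := by
  have hup : IsUpperSet {t | ρ (Set.Ici t) ≤ a} := by
    intro s t hst hs
    exact (measure_mono (Set.Ici_subset_Ici.2 hst)).trans hs
  have hm : MeasurableSet {t | ρ (Set.Ici t) ≤ a} := hup.ordConnected.measurableSet
  by_contra hlt
  rw [not_le] at hlt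
  obtain ⟨K, hK, hKc, hr⟩ := hm.exists_lt_isCompact hlt
  have hne : K.Nonempty := by
    by_contra h
    rw [Set.not_nonempty_iff_eq_empty] at h
    simp [h] at hr
  obtain ⟨t, ht, hmin⟩ := hKc.exists_isMinOn hne continuousOn_id
  have : ρ K ≤ ρ (Set.Ici t) := measure_mono fun s hs => hmin hs
  exact absurd (hr.trans_le (this.trans (hK ht))) (lt_irrefl _)

lemma valid_of_kernel {Ω : Type*} [MeasurableSpace Ω] (P : Measure Ω) [IsProbabilityMeasure P]
    (κ : Ω → Measure Ω) (hκ : ∀ w, IsProbabilityMeasure (κ w)) (S : Ω → ℝ) (hS : Measurable S)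
    (a : ENNReal)
    (h1 : ∀ B, MeasurableSet B → ∫⁻ w, κ w B ∂P = P B)
    (h2 : ∀ w, ∀ᵐ w' ∂κ w, κ w' = κ w)
    (hE : MeasurableSet {w | κ w {w' | S w ≤ S w'} ≤ a}) :
    P {w | κ w {w' | S w ≤ S w'} ≤ a} ≤ a := by
  rw [← h1 _ hE]
  calc ∫⁻ w, κ w {w | κ w {w' | S w ≤ S w'} ≤ a} ∂P ≤ ∫⁻ _, a ∂P := by
        refine lintegral_mono fun w => ?_
        have hp : IsProbabilityMeasure ((κ w).map S) :=
          Measure.isProbabilityMeasure_map hS.aemeasurable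
        have key := tail_prob_le ((κ w).map S) a
        refine le_trans ?_ (le_trans (Measure.le_map_apply hS.aemeasurable _) key)
        refine measure_mono_ae ?_
        filter_upwards [h2 w] with w' hw' hmem
        change κ w' {w'' | S w' ≤ S w''} ≤ a at hmem
        change (κ w).map S (Set.Ici (S w')) ≤ a
        rw [Measure.map_apply hS measurableSet_Ici, ← hw']
        exact hmem
    _ = a := by simp

instance (k : ℕ) : IsProbabilityMeasure (stdGaussianPi k) := by
  unfold stdGaussianPi; infer_instance

lemma pi_ext {n : ℕ} (μ ν : Measure (Fin n → ℝ)) [IsFiniteMeasure μ] [IsFiniteMeasure ν]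
    (h : ∀ t : Fin n → ℝ, ∫ x, Complex.exp (((x ⬝ᵥ t : ℝ) : ℂ) * Complex.I) ∂μ
      = ∫ x, Complex.exp (((x ⬝ᵥ t : ℝ) : ℂ) * Complex.I) ∂ν) : μ = ν := by
  refine (MeasurableEquiv.toLp 2 (Fin n → ℝ)).map_measurableEquiv_injective
      <| Measure.ext_of_charFun (E := EuclideanSpace ℝ (Fin n)) <| funext fun t ↦ ?_
  have := h (WithLp.ofLp t)
  rw [charFun_apply, charFun_apply, integral_map_equiv, integral_map_equiv]
  convert this using 4 <;>
  simp [PiLp.inner_apply, dotProduct, mul_comm]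

lemma std_char {n : ℕ} (t : Fin n → ℝ) :
    ∫ x, Complex.exp (((x ⬝ᵥ t : ℝ) : ℂ) * Complex.I) ∂(stdGaussianPi n)
      = Complex.exp (-((t ⬝ᵥ t : ℝ) : ℂ) / 2) := by
  have h := charFun_stdGaussian (E := EuclideanSpace ℝ (Fin n)) (WithLp.toLp 2 t)
  rw [← map_pi_eq_stdGaussian, charFun_apply,
    show (WithLp.toLp 2 : (Fin n → ℝ) → EuclideanSpace ℝ (Fin n))
      = MeasurableEquiv.toLp 2 (Fin n → ℝ) from rfl, integral_map_equiv] at h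
  change _ = Complex.exp (- ((‖WithLp.toLp 2 t‖ : ℝ) : ℂ) ^ 2 / 2) at h
  have e : ‖WithLp.toLp 2 t‖ ^ 2 = t ⬝ᵥ t := by
    rw [EuclideanSpace.real_norm_sq_eq]
    simp [dotProduct, sq]
  have e' : ((‖WithLp.toLp 2 t‖ : ℝ) : ℂ) ^ 2 = ((t ⬝ᵥ t : ℝ) : ℂ) := by
    rw [← e]; push_cast; rfl
  rw [e'] at h
  rw [← h]
  unfold stdGaussianPi
  congr 1
  ext x
  simp [PiLp.inner_apply, dotProduct, mul_comm]

lemma std_map {n : ℕ} (f f' : (Fin n → ℝ) → (Fin n → ℝ)) (hf : Measurable f)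
    (h1 : ∀ x t, f x ⬝ᵥ t = x ⬝ᵥ f' t) (h2 : ∀ t, f' t ⬝ᵥ f' t = t ⬝ᵥ t) :
    (stdGaussianPi n).map f = stdGaussianPi n := by
  have : IsProbabilityMeasure ((stdGaussianPi n).map f) :=
    Measure.isProbabilityMeasure_map hf.aemeasurable
  refine pi_ext _ _ fun t => ?_
  rw [integral_map hf.aemeasurable (by
    apply Measurable.aestronglyMeasurable; unfold dotProduct; fun_prop)]
  simp_rw [h1]
  rw [std_char, std_char, h2]

/-- The tail of a vector. -/
def tl {n : ℕ} (b : ℕ) (w : Fin n → ℝ) : Fin n → ℝ := fun i => if (i : ℕ) < n - b then 0 else w i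

lemma tns_eq {n : ℕ} (b : ℕ) (w : Fin n → ℝ) : tailNormSq b w = tl b w ⬝ᵥ tl b w := by
  unfold tailNormSq tl dotProduct
  rw [Finset.sum_filter]
  refine Finset.sum_congr rfl fun i _ => ?_
  by_cases h : (i : ℕ) < n - b
  · rw [if_neg (not_le.2 h)]; simp [h]
  · rw [if_pos (not_lt.1 h)]; simp [h, sq]

lemma tns_nonneg {n : ℕ} (b : ℕ) (w : Fin n → ℝ) : 0 ≤ tailNormSq b w :=
  Finset.sum_nonneg fun _ _ => sq_nonneg _

lemma tl_dot {n : ℕ} (b : ℕ) (w t : Fin n → ℝ) : tl b w ⬝ᵥ t = w ⬝ᵥ tl b t := by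
  unfold tl dotProduct
  refine Finset.sum_congr rfl fun i _ => ?_
  beta_reduce
  split_ifs <;> simp

lemma tl_tl {n : ℕ} (b : ℕ) (w : Fin n → ℝ) : tl b (tl b w) = tl b w := by
  ext i; unfold tl; split_ifs <;> rfl

lemma wStar_eq {n : ℕ} (b : ℕ) (w g : Fin n → ℝ) : wStar b w g =
    (w - tl b w) + (Real.sqrt (tailNormSq b w) / Real.sqrt (tailNormSq b g)) • tl b g := by
  ext i
  simp only [wStar, tl, Pi.add_apply, Pi.sub_apply, Pi.smul_apply, smul_eq_mul]
  split_ifs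
  · simp
  · simp; ring

lemma wStar_tns {n : ℕ} (b : ℕ) (w g : Fin n → ℝ) (hg : tailNormSq b g ≠ 0) :
    tailNormSq b (wStar b w g) = tailNormSq b w := by
  have h : tl b (wStar b w g)
      = (Real.sqrt (tailNormSq b w) / Real.sqrt (tailNormSq b g)) • tl b g := by
    rw [wStar_eq]
    ext i
    simp only [tl, Pi.add_apply, Pi.sub_apply, Pi.smul_apply, smul_eq_mul]
    split_ifs <;> simp
  rw [tns_eq, h, smul_dotProduct, dotProduct_smul, ← tns_eq, smul_eq_mul, smul_eq_mul]
  have := Real.sq_sqrt (tns_nonneg b w)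
  have h3 := Real.sq_sqrt (tns_nonneg b g)
  have h4 : Real.sqrt (tailNormSq b g) ≠ 0 :=
    Real.sqrt_ne_zero'.2 (lt_of_le_of_ne (tns_nonneg b g) hg.symm)
  rw [← mul_assoc, div_mul_div_comm, ← sq, ← sq, this, h3]
  field_simp

lemma wStar_head {n : ℕ} (b : ℕ) (w g : Fin n → ℝ) :
    wStar b w g - tl b (wStar b w g) = w - tl b w := by
  ext i
  simp only [wStar, tl, Pi.sub_apply]
  split_ifs <;> simp

lemma wStar_norm {n : ℕ} (b : ℕ) (w g : Fin n → ℝ) (hg : tailNormSq b g ≠ 0) :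
    wStar b w g ⬝ᵥ wStar b w g = w ⬝ᵥ w := by
  have split : ∀ v : Fin n → ℝ, v ⬝ᵥ v = (v - tl b v) ⬝ᵥ (v - tl b v) + tailNormSq b v := by
    intro v
    rw [tns_eq]
    simp only [tl, dotProduct, ← Finset.sum_add_distrib]
    refine Finset.sum_congr rfl fun i _ => ?_
    simp only [Pi.sub_apply, tl]
    split_ifs <;> ring
  rw [split, split w, wStar_tns b w g hg, wStar_head]

lemma tns_ae {n : ℕ} (hn : 1 ≤ n) (b : ℕ) (hb : 1 ≤ b) :
    ∀ᵐ g ∂(stdGaussianPi n), tailNormSq b g ≠ 0 := by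
  have : NullSingletonClass (gaussianReal 0 1) := nullSingletonClass_gaussianReal one_ne_zero
  have := Measure.pi_hyperplane (fun _ : Fin n => gaussianReal 0 1) ⟨n - 1, by omega⟩ (0 : ℝ)
  rw [ae_iff]
  refine measure_mono_null ?_ this
  intro g hg
  simp only [ne_eq, not_not, Set.mem_ofPred_eq] at hg
  have h := (Finset.sum_eq_zero_iff_of_nonneg (fun i _ => sq_nonneg _)).1 hg ⟨n - 1, by omega⟩
    (by simp; omega)
  simpa using h

lemma measurable_tns {n : ℕ} (b : ℕ) : Measurable (tailNormSq (n := n) b) := by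
  unfold tailNormSq; fun_prop

lemma measurable_wStar {n : ℕ} (b : ℕ) :
    Measurable (fun p : (Fin n → ℝ) × (Fin n → ℝ) => wStar b p.1 p.2) := by
  rw [measurable_pi_iff]
  intro i
  unfold wStar
  have := measurable_tns (n := n) b
  split_ifs <;> fun_prop

lemma meas_exp {n : ℕ} {α : Type*} [MeasurableSpace α] {f g : α → Fin n → ℝ}
    (hf : Measurable f) (hg : Measurable g) :
    Measurable fun p => Complex.exp (((f p ⬝ᵥ g p : ℝ) : ℂ) * Complex.I) := by
  have h : Measurable fun p => f p ⬝ᵥ g p := by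
    unfold dotProduct; fun_prop
  fun_prop

lemma int_exp {n : ℕ} {α : Type*} [MeasurableSpace α] (μ : Measure α) [IsFiniteMeasure μ]
    {f g : α → Fin n → ℝ} (hf : Measurable f) (hg : Measurable g) :
    Integrable (fun p => Complex.exp (((f p ⬝ᵥ g p : ℝ) : ℂ) * Complex.I)) μ := by
  refine (integrable_const (1 : ℝ)).mono (meas_exp hf hg).aestronglyMeasurable ?_
  exact Eventually.of_forall fun p => by rw [Complex.norm_exp_ofReal_mul_I]; simp

/-- Invariance of the tail direction under reflections. -/
lemma dir_inv {n : ℕ} (b : ℕ) (a a' : Fin n → ℝ) (ha : tl b a = a) (ha' : tl b a' = a')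
    (haa : a ⬝ᵥ a = a' ⬝ᵥ a') :
    ∫ g, Complex.exp ((((g ⬝ᵥ a) / Real.sqrt (tailNormSq b g) : ℝ) : ℂ) * Complex.I)
        ∂(stdGaussianPi n)
      = ∫ g, Complex.exp ((((g ⬝ᵥ a') / Real.sqrt (tailNormSq b g) : ℝ) : ℂ) * Complex.I)
        ∂(stdGaussianPi n) := by
  by_cases hv : a = a'
  · rw [hv]
  set v := a - a' with hvdef
  have hv0 : v ⬝ᵥ v ≠ 0 := by
    rw [Ne, dotProduct_self_eq_zero]
    exact sub_ne_zero.2 hv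
  have htv : tl b v = v := by
    rw [hvdef]; conv_rhs => rw [← ha, ← ha']
    ext i; simp only [tl, Pi.sub_apply]; split_ifs <;> simp
  let Q : (Fin n → ℝ) → (Fin n → ℝ) := fun x => x - (2 * (x ⬝ᵥ v) / (v ⬝ᵥ v)) • v
  have hQm : Measurable Q := by
    simp only [Q]; unfold dotProduct
    rw [measurable_pi_iff]; intro i
    simp only [Pi.sub_apply, Pi.smul_apply]
    fun_prop
  have hQs : ∀ x t, Q x ⬝ᵥ t = x ⬝ᵥ Q t := by
    intro x t
    simp only [Q, sub_dotProduct, dotProduct_sub, smul_dotProduct, dotProduct_smul, smul_eq_mul]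
    rw [dotProduct_comm t v]
    ring
  have hQn : ∀ t, Q t ⬝ᵥ Q t = t ⬝ᵥ t := by
    intro t
    simp only [Q, sub_dotProduct, dotProduct_sub, smul_dotProduct, dotProduct_smul, smul_eq_mul]
    rw [dotProduct_comm v t]
    field_simp
    ring
  have hQa : Q a = a' := by
    have : 2 * (a ⬝ᵥ v) = v ⬝ᵥ v := by
      simp only [hvdef, sub_dotProduct, dotProduct_sub]
      rw [dotProduct_comm a' a]; linarith
    simp only [Q]
    rw [this, div_self hv0, one_smul, hvdef]
    abel
  have hQt : ∀ x, tailNormSq b (Q x) = tailNormSq b x := by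
    intro x
    have : tl b (Q x) = Q (tl b x) := by
      have h3 : tl b x ⬝ᵥ v = x ⬝ᵥ v := by rw [tl_dot, htv]
      simp only [Q, h3]
      generalize 2 * x ⬝ᵥ v / v ⬝ᵥ v = r
      conv_rhs => rw [← htv]
      ext i; simp only [tl, Pi.sub_apply, Pi.smul_apply, smul_eq_mul]
      split_ifs <;> simp
    rw [tns_eq, this, hQn, ← tns_eq]
  have hm := measurable_tns (n := n) b
  conv_lhs => rw [← std_map Q Q hQm hQs hQn]
  rw [integral_map hQm.aemeasurable (by
    apply Measurable.aestronglyMeasurable; unfold dotProduct; fun_prop)]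
  simp_rw [hQt, hQs, hQa]

lemma wStar_dot {n : ℕ} (b : ℕ) (w g t : Fin n → ℝ) : wStar b w g ⬝ᵥ t =
    (w - tl b w) ⬝ᵥ t
      + (g ⬝ᵥ (Real.sqrt (tailNormSq b w) • tl b t)) / Real.sqrt (tailNormSq b g) := by
  rw [wStar_eq, add_dotProduct, smul_dotProduct, dotProduct_smul, tl_dot]
  simp only [smul_eq_mul]; ring

lemma wStar_char {n : ℕ} (b : ℕ) (w t : Fin n → ℝ) :
    ∫ g, Complex.exp (((wStar b w g ⬝ᵥ t : ℝ) : ℂ) * Complex.I) ∂(stdGaussianPi n)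
      = ∫ g, Complex.exp (((w ⬝ᵥ wStar b t g : ℝ) : ℂ) * Complex.I) ∂(stdGaussianPi n) := by
  have tls : ∀ (r : ℝ) (x : Fin n → ℝ), tl b (r • tl b x) = r • tl b x := by
    intro r x; ext i; simp only [tl, Pi.smul_apply, smul_eq_mul]; split_ifs <;> simp
  have h := dir_inv b (Real.sqrt (tailNormSq b w) • tl b t) (Real.sqrt (tailNormSq b t) • tl b w)
    (tls _ _) (tls _ _) (by
      simp only [smul_dotProduct, dotProduct_smul, smul_eq_mul, ← tns_eq]
      rw [← mul_assoc, ← mul_assoc, Real.mul_self_sqrt (tns_nonneg _ _),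
        Real.mul_self_sqrt (tns_nonneg _ _), mul_comm])
  have e : ∀ g, w ⬝ᵥ wStar b t g = (w - tl b w) ⬝ᵥ t
      + (g ⬝ᵥ (Real.sqrt (tailNormSq b t) • tl b w)) / Real.sqrt (tailNormSq b g) := by
    intro g
    rw [dotProduct_comm, wStar_dot, sub_dotProduct, sub_dotProduct, tl_dot, tl_dot,
      dotProduct_comm t w, dotProduct_comm t, tl_dot]
  simp_rw [e, wStar_dot, Complex.ofReal_add, add_mul, Complex.exp_add]
  rw [integral_const_mul, integral_const_mul, h]

set_option maxHeartbeats 2000000 in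
lemma wStar_law {n : ℕ} (hn : 1 ≤ n) (b : ℕ) (hb : 1 ≤ b) :
    ((stdGaussianPi n).prod (stdGaussianPi n)).map
      (fun p : (Fin n → ℝ) × (Fin n → ℝ) => wStar b p.1 p.2) = stdGaussianPi n := by
  have hm := measurable_wStar (n := n) b
  have : IsProbabilityMeasure (((stdGaussianPi n).prod (stdGaussianPi n)).map
      (fun p : (Fin n → ℝ) × (Fin n → ℝ) => wStar b p.1 p.2)) :=
    Measure.isProbabilityMeasure_map hm.aemeasurable
  refine pi_ext _ _ fun t => ?_
  rw [integral_map hm.aemeasurable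
    (by exact (meas_exp measurable_id measurable_const).aestronglyMeasurable)]
  rw [integral_prod _ (int_exp _ hm measurable_const)]
  simp_rw [wStar_char]
  have hm2 : Measurable fun p : (Fin n → ℝ) × (Fin n → ℝ) => wStar b t p.2 :=
    hm.comp (measurable_const.prodMk measurable_snd)
  rw [integral_integral_swap (int_exp _ measurable_fst hm2)]
  simp_rw [std_char]
  have : ∀ᵐ g ∂(stdGaussianPi n), Complex.exp (-((wStar b t g ⬝ᵥ wStar b t g : ℝ) : ℂ) / 2)
      = Complex.exp (-((t ⬝ᵥ t : ℝ) : ℂ) / 2) := by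
    refine (tns_ae hn b hb).mono fun g hg => ?_
    rw [wStar_norm b t g hg]
  rw [integral_congr_ae this]
  simp

/-- The law of the rotated responses. -/
def lawW {n : ℕ} (m : Fin n → ℝ) (σ : ℝ) : Measure (Fin n → ℝ) :=
  (stdGaussianPi n).map fun g => m + σ • g

lemma measurable_aff {n : ℕ} (m : Fin n → ℝ) (σ : ℝ) :
    Measurable fun g : Fin n → ℝ => m + σ • g := by fun_prop

instance {n : ℕ} (m : Fin n → ℝ) (σ : ℝ) : IsProbabilityMeasure (lawW m σ) :=
  Measure.isProbabilityMeasure_map (measurable_aff m σ).aemeasurable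

lemma wStar_lawW {n : ℕ} (hn : 1 ≤ n) (b : ℕ) (hb : 1 ≤ b) (m : Fin n → ℝ) (σ : ℝ) (hσ : 0 < σ)
    (hm : ∀ i : Fin n, n - b ≤ (i : ℕ) → m i = 0) :
    ((lawW m σ).prod (stdGaussianPi n)).map
        (fun p : (Fin n → ℝ) × (Fin n → ℝ) => wStar b p.1 p.2) = lawW m σ := by
  have hwm := measurable_wStar (n := n) b
  have h2 : (lawW m σ).prod (stdGaussianPi n)
      = ((stdGaussianPi n).prod (stdGaussianPi n)).map
        (Prod.map (fun g => m + σ • g) id) := by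
    rw [← Measure.map_prod_map _ _ (measurable_aff m σ) measurable_id, Measure.map_id]; rfl
  rw [h2, Measure.map_map hwm ((measurable_aff m σ).prodMap measurable_id)]
  have h3 : (fun p : (Fin n → ℝ) × (Fin n → ℝ) => wStar b p.1 p.2)
        ∘ (Prod.map (fun g => m + σ • g) id)
      = (fun g => m + σ • g) ∘ (fun p : (Fin n → ℝ) × (Fin n → ℝ) => wStar b p.1 p.2) := by
    ext p i
    simp only [Function.comp, Prod.map, id]
    have h4 : tailNormSq b (m + σ • p.1) = σ ^ 2 * tailNormSq b p.1 := by
      unfold tailNormSq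
      rw [Finset.mul_sum]
      refine Finset.sum_congr rfl fun i hi => ?_
      simp [hm i (Finset.mem_filter.1 hi).2]; ring
    simp only [wStar, h4, Pi.add_apply, Pi.smul_apply, smul_eq_mul,
      Real.sqrt_mul (sq_nonneg σ), Real.sqrt_sq hσ.le]
    split_ifs with h
    · rfl
    · rw [hm i (not_lt.1 h)]; ring
  rw [h3, ← Measure.map_map (measurable_aff m σ) hwm, wStar_law hn b hb]
  rfl

set_option maxHeartbeats 2000000 in
lemma cont_valid {n : ℕ} (hn : 1 ≤ n) (b : ℕ) (hb : 1 ≤ b) (m : Fin n → ℝ) (σ : ℝ) (hσ : 0 < σ)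
    (hm : ∀ i : Fin n, n - b ≤ (i : ℕ) → m i = 0) (S : (Fin n → ℝ) → ℝ) (hS : Measurable S)
    (a : ENNReal) :
    lawW m σ {w | stdGaussianPi n {g | S w ≤ S (wStar b w g)} ≤ a} ≤ a := by
  have hwm := measurable_wStar (n := n) b
  have hw1 : ∀ w : Fin n → ℝ, Measurable (wStar b w) := fun w =>
    hwm.comp (measurable_const.prodMk measurable_id)
  have eqset : ∀ w, ((stdGaussianPi n).map (wStar b w)) {w' | S w ≤ S w'}
      = stdGaussianPi n {g | S w ≤ S (wStar b w g)} := fun w =>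
    Measure.map_apply (hw1 w) (measurableSet_le measurable_const hS)
  have key := valid_of_kernel (lawW m σ) (fun w => (stdGaussianPi n).map (wStar b w))
    (fun w => Measure.isProbabilityMeasure_map (hw1 w).aemeasurable) S hS a ?_ ?_ ?_
  · simp_rw [eqset] at key
    exact key
  · intro B hB
    have h1 := wStar_lawW hn b hb m σ hσ hm
    conv_rhs => rw [← h1]
    rw [Measure.map_apply hwm hB, Measure.prod_apply (hwm hB)]
    refine lintegral_congr fun w => ?_
    rw [Measure.map_apply (hw1 w) hB]
    rfl
  · intro w
    have hae : ∀ᵐ w' ∂((stdGaussianPi n).map (wStar b w)),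
        tailNormSq b w' = tailNormSq b w ∧ w' - tl b w' = w - tl b w := by
      rw [ae_map_iff (hw1 w).aemeasurable (by
        refine MeasurableSet.inter ?_ ?_
        · exact measurableSet_eq_fun (measurable_tns b) measurable_const
        · refine measurableSet_eq_fun ?_ measurable_const
          rw [measurable_pi_iff]
          intro i
          simp only [tl, Pi.sub_apply]
          split_ifs <;> fun_prop)]
      exact (tns_ae hn b hb).mono fun g hg => ⟨wStar_tns b w g hg, wStar_head b w g⟩
    refine hae.mono fun w' hw' => ?_
    have : wStar b w' = wStar b w := by
      ext g : 1
      rw [wStar_eq, wStar_eq, hw'.1, hw'.2]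
    rw [this]
  · simp_rw [eqset]
    refine measurableSet_le ?_ measurable_const
    exact measurable_measure_prodMk_left (ν := stdGaussianPi n)
      (s := {p : (Fin n → ℝ) × (Fin n → ℝ) | S p.1 ≤ S (wStar b p.1 p.2)})
      (measurableSet_le (hS.comp measurable_fst) (hS.comp hwm))


lemma mem_permSet {n b : ℕ} {ψ : Equiv.Perm (Fin n)} :
    ψ ∈ permSet n b ↔ ∀ i : Fin n, (i : ℕ) < n - b → ψ i = i := by
  simp [permSet]

lemma one_mem_permSet (n b : ℕ) : 1 ∈ permSet n b := mem_permSet.2 fun _ _ => rfl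

lemma mul_mem_permSet {n b : ℕ} {ψ ψ' : Equiv.Perm (Fin n)} (h : ψ ∈ permSet n b) :
    ψ' ∈ permSet n b ↔ ψ * ψ' ∈ permSet n b := by
  rw [mem_permSet] at h
  rw [mem_permSet, mem_permSet]
  refine forall_congr' fun i => imp_congr_right fun hi => ?_
  rw [Equiv.Perm.mul_apply]
  constructor
  · intro e; rw [e, h i hi]
  · intro e; exact ψ.injective (e.trans (h i hi).symm)

lemma perm_lawW {n b : ℕ} (m : Fin n → ℝ) (σ : ℝ)
    (hm : ∀ i : Fin n, n - b ≤ (i : ℕ) → m i = 0) {ψ : Equiv.Perm (Fin n)}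
    (h : ψ ∈ permSet n b) : (lawW m σ).map (fun w => w ∘ ψ) = lawW m σ := by
  rw [mem_permSet] at h
  have hmψ : m ∘ ψ = m := by
    ext i
    by_cases hi : (i : ℕ) < n - b
    · simp [h i hi]
    · have : n - b ≤ (ψ i : ℕ) := by
        by_contra hc
        rw [not_le] at hc
        have e := ψ.injective (h _ hc)
        rw [e] at hc
        exact hi hc
      simp [hm _ this, hm i (not_lt.1 hi)]
  have hc : Measurable fun w : Fin n → ℝ => w ∘ ψ := by
    rw [measurable_pi_iff]; intro i; exact measurable_pi_apply _
  unfold lawW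
  rw [Measure.map_map hc (measurable_aff m σ)]
  have : (fun w : Fin n → ℝ => w ∘ ψ) ∘ (fun g => m + σ • g)
      = (fun g => m + σ • g) ∘ (fun w : Fin n → ℝ => w ∘ ψ) := by
    ext g i
    have := congrFun hmψ i
    simp only [Function.comp] at this
    simp [this]
  rw [this, ← Measure.map_map (measurable_aff m σ) hc]
  congr 1
  refine std_map _ (fun t => t ∘ ψ.symm) hc ?_ ?_
  · intro x t
    unfold dotProduct
    rw [← Equiv.sum_comp ψ (fun i => x i * (t ∘ ψ.symm) i)]
    simp
  · intro t
    unfold dotProduct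
    exact Equiv.sum_comp ψ.symm (fun i => t i * t i)

/-- Conditional law of the permuted vector. -/
def kD {n : ℕ} (b : ℕ) (w : Fin n → ℝ) : Measure (Fin n → ℝ) :=
  ((permSet n b).card : ENNReal)⁻¹ • ∑ ψ ∈ permSet n b, Measure.dirac (w ∘ ψ)

lemma kD_apply {n : ℕ} (b : ℕ) (w : Fin n → ℝ) (B : Set (Fin n → ℝ)) :
    kD b w B = ((permSet n b).card : ENNReal)⁻¹
      * ∑ ψ ∈ permSet n b, B.indicator 1 (w ∘ ψ) := by
  simp [kD, Measure.finsetSum_apply]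

lemma card_ne (n b : ℕ) : ((permSet n b).card : ENNReal) ≠ 0 := by
  simpa using Finset.ne_empty_of_mem (one_mem_permSet n b)

lemma disc_valid {n : ℕ} (b : ℕ) (m : Fin n → ℝ) (σ : ℝ)
    (hm : ∀ i : Fin n, n - b ≤ (i : ℕ) → m i = 0) (S : (Fin n → ℝ) → ℝ) (hS : Measurable S)
    (a : ENNReal) :
    lawW m σ {w | kD b w {w' | S w ≤ S w'} ≤ a} ≤ a := by
  have hc : ∀ ψ : Equiv.Perm (Fin n), Measurable fun w : Fin n → ℝ => w ∘ ψ := by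
    intro ψ; rw [measurable_pi_iff]; intro i; exact measurable_pi_apply _
  have hcard : ((permSet n b).card : ENNReal)⁻¹ * ((permSet n b).card : ENNReal) = 1 :=
    ENNReal.inv_mul_cancel (card_ne n b) (ENNReal.natCast_ne_top _)
  refine valid_of_kernel (lawW m σ) (kD b) ?_ S hS a ?_ ?_ ?_
  · intro w
    constructor
    rw [kD_apply]
    simpa using hcard
  · intro B hB
    simp_rw [kD_apply]
    have hi : ∀ ψ : Equiv.Perm (Fin n), Measurable fun w : Fin n → ℝ =>
        (B.indicator 1 (w ∘ ψ) : ENNReal) := fun ψ =>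
      (measurable_one.indicator hB).comp (hc ψ)
    rw [lintegral_const_mul _ (Finset.measurable_fun_sum _ fun ψ _ => hi ψ),
      lintegral_finsetSum _ fun ψ _ => hi ψ]
    have : ∀ ψ ∈ permSet n b, ∫⁻ w, (B.indicator 1 (w ∘ ψ) : ENNReal) ∂(lawW m σ)
        = lawW m σ B := by
      intro ψ hψ
      conv_rhs => rw [← perm_lawW m σ hm hψ]
      rw [← lintegral_indicator_one hB, lintegral_map (measurable_one.indicator hB) (hc ψ)]
    rw [Finset.sum_congr rfl this, Finset.sum_const, nsmul_eq_mul, ← mul_assoc, hcard, one_mul]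
  · intro w
    rw [ae_iff, kD_apply]
    rw [Finset.sum_eq_zero, mul_zero]
    intro ψ hψ
    refine Set.indicator_of_notMem ?_ _
    simp only [Set.mem_ofPred_eq, not_not]
    unfold kD
    congr 1
    exact Finset.sum_equiv (Equiv.mulLeft ψ) (fun ψ' => mul_mem_permSet hψ) (fun ψ' _ => rfl)
  · simp_rw [kD_apply]
    refine measurableSet_le ?_ measurable_const
    refine Measurable.const_mul (Finset.measurable_fun_sum _ fun ψ _ => ?_) _
    have : (fun w : Fin n → ℝ => ({w' | S w ≤ S w'}.indicator 1 (w ∘ ψ) : ENNReal))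
        = {w | S w ≤ S (w ∘ ψ)}.indicator 1 := by
      ext w; simp [Set.indicator]
    rw [this]
    exact measurable_one.indicator (measurableSet_le hS (hS.comp (hc ψ)))

/-- Rank bound: the eigenvalues with index at least `q` vanish. -/
lemma eig_zero {n q : ℕ} (u : Fin n → Fin q → ℝ) (c : Fin n → ℝ)
    (hu : ∀ i j, u i ⬝ᵥ u j = if i = j then c i else 0)
    (hc : ∀ i j : Fin n, i ≤ j → c j ≤ c i) (hc0 : ∀ i, 0 ≤ c i) (i : Fin n) (hi : q ≤ i) :
    u i = 0 := by
  by_contra hne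
  have hci : 0 < c i := by
    refine lt_of_le_of_ne (hc0 i) fun h => hne ?_
    have := hu i i
    rw [if_pos rfl, ← h] at this
    exact dotProduct_self_eq_zero.1 this
  let e : Fin (q + 1) → Fin n := fun k => ⟨k, by omega⟩
  have hei : Function.Injective e := by
    intro a b hab
    simpa [e, Fin.ext_iff] using hab
  have hli : LinearIndependent ℝ (fun k => u (e k)) := by
    rw [Fintype.linearIndependent_iff]
    intro g hg k
    have h1 : (∑ k', g k' • u (e k')) ⬝ᵥ u (e k) = 0 := by rw [hg, zero_dotProduct]
    rw [sum_dotProduct] at h1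
    simp only [smul_dotProduct, hu, hei.eq_iff, smul_eq_mul, mul_ite, mul_zero,
      Finset.sum_ite_eq', Finset.mem_univ, if_true] at h1
    have : 0 < c (e k) := hci.trans_le (hc _ _ (by
      rw [Fin.le_def]; simp only [e]; omega))
    exact (mul_eq_zero.1 h1).resolve_right this.ne'
  have := hli.fintype_card_le_finrank
  simp at this

end PPT

open PPT in
/-- Corollary 5, `cor:kernel_finite_dim_feature_space_corr`: validity of the
discrete and continuous partial permutation tests with covariance matrix `Σ`, for a kernel with
finite-dimensional feature space `K(x,x') = φ(x)ᵀφ(x')`, when the true regression function is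
linear in the features and the noise is `N(0, σ₀² Σ)`. -/
theorem partial_permutation_valid_finite_feature_correlated
    {n d H q : ℕ} (hn : 1 ≤ n)
    (X : Fin n → Fin d → ℝ) (Z : Fin n → Fin H)
    -- the feature map defining the kernel K(x,x') = φ(x)ᵀφ(x')
    (φ : (Fin d → ℝ) → Fin q → ℝ)
    -- the true functional relationship is linear in the features
    (f0 : (Fin d → ℝ) → ℝ) (β : Fin q → ℝ)
    (hf0 : ∀ x, f0 x = ∑ l, β l * φ x l)
    -- noise level
    (σ0 : ℝ) (hσ0 : 0 < σ0)
    -- known positive definite covariance structure Σ, with square root Sh = Σ^{1/2} and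
    -- inverse square root R = Σ^{-1/2}
    (Sig Sh R : Fin n → Fin n → ℝ)
    (hSig : IsPosDefF Sig) (hSqrt : IsSqrtPair Sig Sh R)
    -- the law of Y = f0(X) + ε with ε ~ N(0, σ₀² Σ), realized as ε = σ₀ Σ^{1/2} g
    (μY : Measure (Fin n → ℝ))
    (hμY : μY = Measure.map
      (fun g : Fin n → ℝ => fun i => f0 (X i) + σ0 * mulVecF Sh g i) (stdGaussianPi n))
    -- sample kernel matrix and transformed kernel matrix Kₙ^C = Σ^{-1/2} Kₙ Σ^{-1/2}
    (Kn KnC : Fin n → Fin n → ℝ)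
    (hKn : ∀ i j, Kn i j = ∑ l, φ (X i) l * φ (X j) l)
    (hKnC : KnC = mulF R (mulF Kn R))
    -- a fixed eigendecomposition Kₙ^C = Γ diag(c) Γᵀ
    (Γ : Fin n → Fin n → ℝ) (c : Fin n → ℝ) (hEig : IsEigenDecomp KnC Γ c)
    -- permutation size
    (b : ℕ) (hb1 : 1 ≤ b) (hb2 : b ≤ n - q)
    -- arbitrary (measurable) test statistic
    (T : (Fin n → Fin d → ℝ) → (Fin n → ℝ) → (Fin n → Fin H) → ℝ)
    (hT : Measurable fun y => T X y Z) :
    -- validity of the p-values, computed from Y^C = Σ^{-1/2} Y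
    ∀ α ∈ Set.Ioo (0 : ℝ) 1,
      μY {y | pDisc X Z T Γ b (mulVecF R y) ≤ α} ≤ ENNReal.ofReal α ∧
      μY {y | pCont X Z T Γ b (mulVecF R y) ≤ α} ≤ ENNReal.ofReal α := by
  intro α hα
  obtain ⟨hShPD, -, hRS, hSR⟩ := hSqrt
  obtain ⟨hΓ, hK, hcs, hc0⟩ := hEig
  -- matrix versions
  let MΓ : Matrix (Fin n) (Fin n) ℝ := Matrix.of Γ
  let MR : Matrix (Fin n) (Fin n) ℝ := Matrix.of R
  let MS : Matrix (Fin n) (Fin n) ℝ := Matrix.of Sh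
  let MF : Matrix (Fin n) (Fin q) ℝ := Matrix.of fun i l => φ (X i) l
  have eΓ : ∀ v, mulVecF Γ v = MΓ.mulVec v := fun v => rfl
  have eR : ∀ v, mulVecF R v = MR.mulVec v := fun v => rfl
  have eS : ∀ v, mulVecF Sh v = MS.mulVec v := fun v => rfl
  have eT : ∀ v, tmulVecF Γ v = MΓ.transpose.mulVec v := fun v => rfl
  have hΓ1 : MΓ * MΓ.transpose = 1 := by
    ext i j
    rw [Matrix.one_apply]
    exact hΓ i j
  have hΓ2 : MΓ.transpose * MΓ = 1 := mul_eq_one_comm.1 hΓ1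
  have hRS' : MR * MS = 1 := by
    ext i j
    rw [Matrix.one_apply]
    exact congrFun (congrFun hRS i) j
  have hMS : MS.transpose = MS := by
    ext i j
    exact hShPD.1 j i
  have hMR : MR.transpose = MR := by
    have h1 : MS * MR.transpose = 1 := by
      rw [← hMS, ← Matrix.transpose_mul, hRS', Matrix.transpose_one]
    calc MR.transpose = (MR * MS) * MR.transpose := by rw [hRS', one_mul]
      _ = MR := by rw [mul_assoc, h1, mul_one]
  have hKC : Matrix.of KnC = MR * (MF * MF.transpose * MR) := by
    rw [hKnC]
    have : Matrix.of Kn = MF * MF.transpose := by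
      ext i j
      exact hKn i j
    rw [← this]
    rfl
  have hKC2 : Matrix.of KnC = MΓ * Matrix.diagonal c * MΓ.transpose := by
    ext i j
    rw [Matrix.mul_apply]
    simp only [Matrix.mul_diagonal]
    exact hK i j
  let U : Matrix (Fin n) (Fin q) ℝ := MΓ.transpose * MR * MF
  have hU : U * U.transpose = Matrix.diagonal c := by
    have h1 : U * U.transpose = MΓ.transpose * (MR * (MF * MF.transpose * MR)) * MΓ := by
      simp only [U, Matrix.transpose_mul, Matrix.transpose_transpose, hMR, Matrix.mul_assoc]
    rw [h1, ← hKC, hKC2]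
    calc MΓ.transpose * (MΓ * Matrix.diagonal c * MΓ.transpose) * MΓ
        = (MΓ.transpose * MΓ) * Matrix.diagonal c * (MΓ.transpose * MΓ) := by
          simp only [Matrix.mul_assoc]
      _ = Matrix.diagonal c := by rw [hΓ2, one_mul, mul_one]
  have hUz : ∀ i : Fin n, q ≤ (i : ℕ) → U i = 0 := by
    intro i hi
    refine eig_zero (fun i => U i) c ?_ hcs hc0 i hi
    intro i j
    have := congrFun (congrFun hU i) j
    rw [Matrix.diagonal_apply] at this
    exact this
  -- rotated mean
  let m : Fin n → ℝ := U.mulVec β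
  have hm : ∀ i : Fin n, n - b ≤ (i : ℕ) → m i = 0 := by
    intro i hi
    have : U i = 0 := hUz i (by omega)
    simp only [m, Matrix.mulVec]
    rw [this, zero_dotProduct]
  let V : (Fin n → ℝ) → (Fin n → ℝ) := fun y => tmulVecF Γ (mulVecF R y)
  have mmul : ∀ A : Matrix (Fin n) (Fin n) ℝ, Measurable fun v : Fin n → ℝ => A.mulVec v := by
    intro A
    exact (Continuous.matrix_mulVec continuous_const continuous_id).measurable
  have hV : Measurable V := (mmul MΓ.transpose).comp (mmul MR)
  have hlaw : μY.map V = lawW m σ0 := by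
    have haff : Measurable fun g : Fin n → ℝ => fun i => f0 (X i) + σ0 * mulVecF Sh g i := by
      rw [measurable_pi_iff]
      intro i
      have := (measurable_pi_iff.1 (mmul MS)) i
      exact (this.const_mul σ0).const_add _
    rw [hμY, Measure.map_map hV haff]
    have e1 : V ∘ (fun g : Fin n → ℝ => fun i => f0 (X i) + σ0 * mulVecF Sh g i)
        = (fun g => m + σ0 • g) ∘ (fun g => MΓ.transpose.mulVec g) := by
      ext g : 1
      simp only [Function.comp, V, eT, eR, eS]
      have e2 : (fun i => f0 (X i) + σ0 * MS.mulVec g i) = MF.mulVec β + σ0 • MS.mulVec g := by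
        ext i
        simp only [Pi.add_apply, Pi.smul_apply, smul_eq_mul, hf0, Matrix.mulVec, dotProduct, MF,
          Matrix.of_apply]
        congr 1
        exact Finset.sum_congr rfl fun l _ => mul_comm _ _
      rw [e2, Matrix.mulVec_add, Matrix.mulVec_add, Matrix.mulVec_smul, Matrix.mulVec_smul,
        Matrix.mulVec_mulVec, Matrix.mulVec_mulVec, Matrix.mulVec_mulVec, Matrix.mulVec_mulVec,
        Matrix.mul_assoc MΓ.transpose MR MS, hRS', mul_one]
    rw [e1, ← Measure.map_map (measurable_aff m σ0) (mmul _)]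
    unfold lawW
    congr 1
    refine std_map _ (fun t => MΓ.mulVec t) (mmul _) ?_ ?_
    · intro x t
      rw [Matrix.mulVec_transpose, ← Matrix.dotProduct_mulVec]
    · intro t
      rw [Matrix.dotProduct_mulVec, ← Matrix.mulVec_transpose, Matrix.mulVec_mulVec, hΓ2,
        Matrix.one_mulVec]
  let S : (Fin n → ℝ) → ℝ := fun w => T X (mulVecF Γ w) Z
  have hS : Measurable S := hT.comp (mmul MΓ)
  have hSV : ∀ y, T X (mulVecF R y) Z = S (V y) := by
    intro y
    simp only [S, V, eΓ, eT, Matrix.mulVec_mulVec, hΓ1, Matrix.one_mulVec]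
  constructor
  · have key := disc_valid b m σ0 hm S hS (ENNReal.ofReal α)
    rw [← hlaw] at key
    refine le_trans ?_ (le_trans (Measure.le_map_apply hV.aemeasurable _) key)
    refine measure_mono fun y hy => ?_
    change pDisc X Z T Γ b (mulVecF R y) ≤ α at hy
    change kD b (V y) {w' | S (V y) ≤ S w'} ≤ ENNReal.ofReal α
    have e : kD b (V y) {w' | S (V y) ≤ S w'}
        = ENNReal.ofReal (pDisc X Z T Γ b (mulVecF R y)) := by
      have hpos : (0 : ℝ) < (permSet n b).card := by
        exact_mod_cast Finset.card_pos.2 ⟨1, one_mem_permSet n b⟩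
      rw [kD_apply, pDisc, ENNReal.ofReal_mul (by positivity), ENNReal.ofReal_inv_of_pos hpos,
        ENNReal.ofReal_natCast, ENNReal.ofReal_sum_of_nonneg (by
          intro ψ _; split_ifs <;> norm_num)]
      congr 1
      refine Finset.sum_congr rfl fun ψ _ => ?_
      rw [hSV]
      change _ = ENNReal.ofReal (if S (V y) ≤ S (V y ∘ ψ) then 1 else 0)
      by_cases h : S (V y) ≤ S (V y ∘ ψ) <;> simp [h]
    rw [e]
    exact ENNReal.ofReal_le_ofReal hy
  · have key := cont_valid hn b hb1 m σ0 hσ0 hm S hS (ENNReal.ofReal α)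
    rw [← hlaw] at key
    refine le_trans ?_ (le_trans (Measure.le_map_apply hV.aemeasurable _) key)
    refine measure_mono fun y hy => ?_
    change pCont X Z T Γ b (mulVecF R y) ≤ α at hy
    change stdGaussianPi n {g | S (V y) ≤ S (wStar b (V y) g)} ≤ ENNReal.ofReal α
    rw [ENNReal.le_ofReal_iff_toReal_le (measure_ne_top _ _) hα.1.le]
    unfold pCont at hy
    rw [hSV] at hy
    exact hy
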